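/- Let μ be a unit pure quaternion, U ∈ ℍ^{n×n×n₃} a unitary tensor, and A ∈ ℍ^{n×n₂×n₃}. Then ‖U *_μ A‖_F = ‖A‖_F. -/

import Mathlib

noncomputable section
open Matrix Kronecker Filter Topology

namespace QTpaper

/-- The quaternion unit `i`. -/
def qi : Quaternion ℝ := ⟨0, 1, 0, 0⟩
/-- The quaternion unit `j`. -/
def qj : Quaternion ℝ := ⟨0, 0, 1, 0⟩
/-- The quaternion unit `k`. -/
def qk : Quaternion ℝ := ⟨0, 0, 0, 1⟩

/-- A unit pure quaternion: zero real part and norm one. -/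
def UnitPure (μ : Quaternion ℝ) : Prop := μ.re = 0 ∧ ‖μ‖ = 1

/-- Third-order quaternion tensors. -/
abbrev QTensor (a b c : ℕ) := Fin a → Fin b → Fin c → Quaternion ℝ

/-- `l`-th frontal slice of a third-order tensor. -/
def fslice {a b c : ℕ} (A : QTensor a b c) (l : Fin c) :
    Matrix (Fin a) (Fin b) (Quaternion ℝ) := fun p q => A p q l

/-- Frobenius norm of a quaternion matrix. -/
def frobM {m n : ℕ} (A : Matrix (Fin m) (Fin n) (Quaternion ℝ)) : ℝ :=
  Real.sqrt (∑ p, ∑ q, ‖A p q‖ ^ 2)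

/-- Frobenius norm of a third-order quaternion tensor. -/
def frobT {a b c : ℕ} (A : QTensor a b c) : ℝ :=
  Real.sqrt (∑ p, ∑ q, ∑ l, ‖A p q l‖ ^ 2)

/-- The normalized QDFT matrix `F_{μ,n}` with entries
`(1/√n)·ω^{(p-1)(q-1)}`, `ω^m = cos(2πm/n) − μ·sin(2πm/n)`. -/
def Fq (μ : Quaternion ℝ) (n : ℕ) : Matrix (Fin n) (Fin n) (Quaternion ℝ) :=
  fun p q =>
    ((1 / Real.sqrt n : ℝ) : Quaternion ℝ) *
      (((Real.cos (2 * Real.pi * (p.1 * q.1) / n) : ℝ) : Quaternion ℝ)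
        - ((Real.sin (2 * Real.pi * (p.1 * q.1) / n) : ℝ) : Quaternion ℝ) * μ)

/-- The permutation matrix `P_n` (1-based: `P₁₁ = 1`, `P_{pq} = 1` for `p+q = n+2`). -/
def Pmat (n : ℕ) : Matrix (Fin n) (Fin n) ℝ :=
  fun p q => if (p.1 = 0 ∧ q.1 = 0) ∨ (p.1 + q.1 = n) then 1 else 0

/-- Block circulant matrix of a third-order tensor. -/
def circ {a b c : ℕ} (A : QTensor a b c) :
    Matrix (Fin c × Fin a) (Fin c × Fin b) (Quaternion ℝ) :=
  fun pi qj => A pi.2 qj.2 (pi.1 - qj.1)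

/-- `unfold` stacks the frontal slices vertically. -/
def unfold3 {a b c : ℕ} (A : QTensor a b c) :
    Matrix (Fin c × Fin a) (Fin b) (Quaternion ℝ) :=
  fun pi q => A pi.2 q pi.1

/-- `fold` is the inverse of `unfold`. -/
def fold3 {a b c : ℕ} (M : Matrix (Fin c × Fin a) (Fin b) (Quaternion ℝ)) :
    QTensor a b c := fun p q l => M (l, p) q

/-- Block diagonal matrix whose `l`-th diagonal block is the `l`-th frontal slice. -/
def diagT {a b c : ℕ} (A : QTensor a b c) :
    Matrix (Fin c × Fin a) (Fin c × Fin b) (Quaternion ℝ) :=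
  fun pi qj => if pi.1 = qj.1 then A pi.2 qj.2 pi.1 else 0

/-- The QDFT along mode 3: `fft(A)(p,q,:) = √n₃ · F_{μ,n₃} · A(p,q,:)`. -/
def fftT {a b c : ℕ} (μ : Quaternion ℝ) (A : QTensor a b c) : QTensor a b c :=
  fun p q l => ((Real.sqrt c : ℝ) : Quaternion ℝ) * ∑ m, Fq μ c l m * A p q m

/-- Real-part component tensor. -/
def compE {a b c : ℕ} (A : QTensor a b c) : QTensor a b c :=
  fun p q l => (((A p q l).re : ℝ) : Quaternion ℝ)
/-- `i`-component tensor. -/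
def compI {a b c : ℕ} (A : QTensor a b c) : QTensor a b c :=
  fun p q l => (((A p q l).imI : ℝ) : Quaternion ℝ)
/-- `j`-component tensor. -/
def compJ {a b c : ℕ} (A : QTensor a b c) : QTensor a b c :=
  fun p q l => (((A p q l).imJ : ℝ) : Quaternion ℝ)
/-- `k`-component tensor. -/
def compK {a b c : ℕ} (A : QTensor a b c) : QTensor a b c :=
  fun p q l => (((A p q l).imK : ℝ) : Quaternion ℝ)

/-- For `μ = a·i + b·j + c·k`, `μ_i = a·i − b·j − c·k`. -/
def mui (μ : Quaternion ℝ) : Quaternion ℝ := ⟨0, μ.imI, -μ.imJ, -μ.imK⟩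
/-- For `μ = a·i + b·j + c·k`, `μ_j = −a·i + b·j − c·k`. -/
def muj (μ : Quaternion ℝ) : Quaternion ℝ := ⟨0, -μ.imI, μ.imJ, -μ.imK⟩
/-- For `μ = a·i + b·j + c·k`, `μ_k = −a·i − b·j + c·k`. -/
def muk (μ : Quaternion ℝ) : Quaternion ℝ := ⟨0, -μ.imI, -μ.imJ, μ.imK⟩

/-- `T` matrix `F_{ν,n}^* · F_{μ,n}`. -/
def Tm (ν μ : Quaternion ℝ) (n : ℕ) : Matrix (Fin n) (Fin n) (Quaternion ℝ) :=
  (Fq ν n)ᴴ * Fq μ n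

/-- The gQt-product of third-order quaternion tensors. -/
def gQt {n₁ r n₂ n₃ : ℕ} (μ : Quaternion ℝ) (A : QTensor n₁ r n₃)
    (B : QTensor r n₂ n₃) : QTensor n₁ n₂ n₃ :=
  fold3 ((circ (compE A)
      + qi • (circ (compI A) * (Tm (mui μ) μ n₃ ⊗ₖ (1 : Matrix (Fin r) (Fin r) (Quaternion ℝ))))
      + qj • (circ (compJ A) * (Tm (muj μ) μ n₃ ⊗ₖ (1 : Matrix (Fin r) (Fin r) (Quaternion ℝ))))
      + qk • (circ (compK A) * (Tm (muk μ) μ n₃ ⊗ₖ (1 : Matrix (Fin r) (Fin r) (Quaternion ℝ)))))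
    * unfold3 B)

/-- The index reversal `1 ↦ 1`, `l ↦ n₃ + 2 − l` (1-based), used in the tensor transpose. -/
def revIdx {c : ℕ} (l : Fin c) : Fin c :=
  if h : l.1 = 0 then l else ⟨c - l.1, by have := l.2; omega⟩

/-- Transpose of a (componentwise real) tensor: transpose each frontal slice and
reverse the order of the transposed slices `2` through `n₃`. -/
def transT {a b c : ℕ} (A : QTensor a b c) : QTensor b a c :=
  fun q p l => A p q (revIdx l)

/-- Right multiplication of a matrix by a quaternion scalar. -/
def rmulM {m n : Type*} (M : Matrix m n (Quaternion ℝ)) (x : Quaternion ℝ) :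
    Matrix m n (Quaternion ℝ) := fun p q => M p q * x

/-- Conjugate transpose of a third-order quaternion tensor. -/
def conjT {n₁ n₂ n₃ : ℕ} (μ : Quaternion ℝ) (A : QTensor n₁ n₂ n₃) : QTensor n₂ n₁ n₃ :=
  fold3 (unfold3 (transT (compE A))
    - rmulM (((Tm (mui μ) μ n₃)ᴴ ⊗ₖ (1 : Matrix (Fin n₂) (Fin n₂) (Quaternion ℝ)))
        * unfold3 (transT (compI A))) qi
    - rmulM (((Tm (muj μ) μ n₃)ᴴ ⊗ₖ (1 : Matrix (Fin n₂) (Fin n₂) (Quaternion ℝ)))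
        * unfold3 (transT (compJ A))) qj
    - rmulM (((Tm (muk μ) μ n₃)ᴴ ⊗ₖ (1 : Matrix (Fin n₂) (Fin n₂) (Quaternion ℝ)))
        * unfold3 (transT (compK A))) qk)

/-- The identity tensor: first frontal slice is the identity, the others vanish. -/
def idT (n l : ℕ) : QTensor n n l :=
  fun p q m => if m.1 = 0 ∧ p = q then 1 else 0

/-- Unitary tensor with respect to the gQt-product. -/
def unitaryT {n n₃ : ℕ} (μ : Quaternion ℝ) (U : QTensor n n n₃) : Prop :=
  gQt μ (conjT μ U) U = idT n n₃ ∧ gQt μ U (conjT μ U) = idT n n₃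

/-- f-diagonal tensor: each frontal slice is a diagonal matrix. -/
def fDiag {a b c : ℕ} (S : QTensor a b c) : Prop :=
  ∀ p q l, p.1 ≠ q.1 → S p q l = 0


/-- The algebra homomorphism `ℂ → ℍ` sending `I` to `-μ`, for a unit pure quaternion `μ`. -/
def complexHom (μ : Quaternion ℝ) (h : (-μ) * (-μ) = -1) : ℂ →ₐ[ℝ] Quaternion ℝ :=
  Complex.lift ⟨-μ, h⟩

theorem complexHom_apply (μ : Quaternion ℝ) (h : (-μ) * (-μ) = -1) (z : ℂ) :
    complexHom μ h z = (z.re : Quaternion ℝ) - (z.im : Quaternion ℝ) * μ := by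
  simp [complexHom, Complex.liftAux_apply, sub_eq_add_neg, Quaternion.coe_mul_eq_smul]

theorem UnitPure.star_eq {μ : Quaternion ℝ} (hμ : UnitPure μ) : star μ = -μ := by
  ext <;> simp [hμ.1]

theorem UnitPure.neg_mul_neg {μ : Quaternion ℝ} (hμ : UnitPure μ) : (-μ) * (-μ) = -1 := by
  have h := Quaternion.star_mul_self (a := μ)
  rw [hμ.star_eq, Quaternion.normSq_eq_norm_mul_self, hμ.2] at h
  simpa [neg_eq_iff_eq_neg] using h

theorem star_complexHom {μ : Quaternion ℝ} (hμ : UnitPure μ) (z : ℂ) :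
    star (complexHom μ hμ.neg_mul_neg z) = complexHom μ hμ.neg_mul_neg (star z) := by
  simp [complexHom_apply, hμ.star_eq, Quaternion.coe_mul_eq_smul]

theorem complexHom_mul_comm {μ ν u : Quaternion ℝ} (hμ : UnitPure μ) (hν : UnitPure ν)
    (h : μ * u = u * ν) (z : ℂ) :
    complexHom μ hμ.neg_mul_neg z * u = u * complexHom ν hν.neg_mul_neg z := by
  simp only [complexHom_apply, sub_mul, mul_sub, Quaternion.coe_mul_eq_smul,
    Quaternion.mul_coe_eq_smul, smul_mul_assoc, mul_smul_comm, h]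

/-- The normalized complex DFT matrix, indexed by `ℤ/(k+1)ℤ`. -/
def dftZMod (k : ℕ) (p q : ZMod (k + 1)) : ℂ :=
  ((1 / Real.sqrt (k + 1 : ℕ) : ℝ) : ℂ) * ZMod.stdAddChar (N := k + 1) (p * q)

theorem dftZMod_star_mul (k : ℕ) (p q : ZMod (k + 1)) :
    ∑ m, star (dftZMod k m p) * dftZMod k m q = if p = q then 1 else 0 := by
  have hs : ((1 / Real.sqrt (k + 1 : ℕ) : ℝ) : ℂ) * ((1 / Real.sqrt (k + 1 : ℕ) : ℝ) : ℂ)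
      = ((1 / (k + 1 : ℕ) : ℝ) : ℂ) := by
    rw [← Complex.ofReal_mul, div_mul_div_comm, one_mul, Real.mul_self_sqrt (by positivity)]
  have h (m : ZMod (k + 1)) : star (dftZMod k m p) * dftZMod k m q =
      ((1 / (k + 1 : ℕ) : ℝ) : ℂ) * ZMod.stdAddChar (m * (q - p)) := by
    rw [dftZMod, dftZMod, star_mul', ← hs, mul_sub, sub_eq_add_neg, AddChar.map_add_eq_mul,
      AddChar.map_neg_eq_conj]
    simp only [RCLike.star_def, Complex.conj_ofReal]
    ring
  rw [Finset.sum_congr rfl fun m _ => h m, ← Finset.mul_sum,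
    AddChar.sum_mulShift (q - p) (ZMod.isPrimitive_stdAddChar (k + 1)), ZMod.card]
  have hk : (k : ℂ) + 1 ≠ 0 := by exact_mod_cast Nat.succ_ne_zero k
  by_cases hpq : p = q
  · simp [hpq, hk]
  · have : q - p ≠ 0 := fun h => hpq (sub_eq_zero.1 h).symm
    rw [if_neg this, if_neg hpq, Nat.cast_zero, mul_zero]

theorem dftZMod_eq_mul (k : ℕ) (l m j : ZMod (k + 1)) :
    dftZMod k l m =
      ((Real.sqrt (k + 1 : ℕ) : ℝ) : ℂ) * (dftZMod k l (m - j) * dftZMod k l j) := by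
  have h : ZMod.stdAddChar (l * m) =
      ZMod.stdAddChar (l * (m - j)) * ZMod.stdAddChar (l * j) := by
    rw [← AddChar.map_add_eq_mul, ← mul_add, sub_add_cancel]
  have hs : ((Real.sqrt (k + 1 : ℕ) : ℝ) : ℂ) ≠ 0 := by
    rw [Complex.ofReal_ne_zero]
    positivity
  rw [dftZMod, dftZMod, dftZMod, h, Complex.ofReal_div, Complex.ofReal_one]
  field_simp

theorem dftZMod_neg (k : ℕ) (l m : ZMod (k + 1)) :
    dftZMod k l (-m) = star (dftZMod k l m) := by
  rw [dftZMod, dftZMod, mul_neg, AddChar.map_neg_eq_conj, star_mul']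
  simp only [RCLike.star_def, Complex.conj_ofReal]

theorem dftZMod_natCast (k p q : ℕ) :
    dftZMod k p q = ((1 / Real.sqrt (k + 1 : ℕ) : ℝ) : ℂ) *
      Complex.exp ((2 * Real.pi * (p * q) / (k + 1 : ℕ) : ℝ) * Complex.I) := by
  have h := ZMod.stdAddChar_coe (N := k + 1) ((p : ℤ) * q)
  push_cast at h
  rw [dftZMod, h]
  congr 2
  push_cast
  ring

/-- The normalized complex DFT matrix, indexed by `Fin (k + 1)`. -/
def dftC (k : ℕ) (p q : Fin (k + 1)) : ℂ := dftZMod k p q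

theorem Fq_eq {μ : Quaternion ℝ} (hμ : UnitPure μ) (k : ℕ) (p q : Fin (k + 1)) :
    Fq μ (k + 1) p q = complexHom μ hμ.neg_mul_neg (dftC k p q) := by
  have hp : ((p.1 : ℕ) : ZMod (k + 1)) = p := ZMod.natCast_zmod_val (n := k + 1) p
  have hq : ((q.1 : ℕ) : ZMod (k + 1)) = q := ZMod.natCast_zmod_val (n := k + 1) q
  have h := dftZMod_natCast k p.1 q.1
  rw [hp, hq] at h
  rw [complexHom_apply, show dftC k p q = _ from h, Complex.re_ofReal_mul, Complex.im_ofReal_mul,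
    Complex.exp_ofReal_mul_I_re, Complex.exp_ofReal_mul_I_im]
  simp only [Fq, Quaternion.coe_mul, mul_sub, mul_assoc]

theorem dftC_star_mul (k : ℕ) (p q : Fin (k + 1)) :
    ∑ m, star (dftC k m p) * dftC k m q = if p = q then 1 else 0 :=
  dftZMod_star_mul k p q

theorem dftC_eq_mul (k : ℕ) (l m j : Fin (k + 1)) :
    dftC k l m = ((Real.sqrt (k + 1 : ℕ) : ℝ) : ℂ) * (dftC k l (m - j) * dftC k l j) :=
  dftZMod_eq_mul k l m j

theorem dftC_neg (k : ℕ) (l m : Fin (k + 1)) : dftC k l (-m) = star (dftC k l m) :=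
  dftZMod_neg k l m

theorem revIdx_eq_neg {k : ℕ} (l : Fin (k + 1)) : revIdx l = -l := by
  ext
  unfold revIdx
  split_ifs with h
  · have : l = 0 := Fin.ext h
    simp [this]
  · have := l.2
    rw [Fin.val_neg', Nat.mod_eq_of_lt (by omega)]

theorem Fq_conjTranspose_mul {μ : Quaternion ℝ} (hμ : UnitPure μ) (k : ℕ) :
    (Fq μ (k + 1))ᴴ * Fq μ (k + 1) = 1 := by
  ext1 p q
  simp only [Matrix.mul_apply, Matrix.conjTranspose_apply, Fq_eq hμ, star_complexHom hμ,
    ← map_mul, ← map_sum, dftC_star_mul, Matrix.one_apply]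
  split_ifs <;> simp

theorem Fq_symm {μ : Quaternion ℝ} (k : ℕ) (p q : Fin (k + 1)) :
    Fq μ (k + 1) p q = Fq μ (k + 1) q p := by
  simp only [Fq, mul_comm (p.1 : ℝ)]

theorem Fq_mul_conjTranspose {μ : Quaternion ℝ} (hμ : UnitPure μ) (k : ℕ) :
    Fq μ (k + 1) * (Fq μ (k + 1))ᴴ = 1 := by
  ext1 p q
  have h (m) : Fq μ (k + 1) p m * star (Fq μ (k + 1) q m) =
      complexHom μ hμ.neg_mul_neg (star (dftC k m q) * dftC k m p) := by
    rw [Fq_symm k p m, Fq_symm k q m, Fq_eq hμ, Fq_eq hμ, star_complexHom hμ, ← map_mul, mul_comm]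
  simp only [Matrix.mul_apply, Matrix.conjTranspose_apply, h, ← map_sum, dftC_star_mul,
    Matrix.one_apply, eq_comm (a := q)]
  split_ifs <;> simp

theorem Fq_mul_Tm {μ ν : Quaternion ℝ} (hν : UnitPure ν) (k : ℕ) :
    Fq ν (k + 1) * Tm ν μ (k + 1) = Fq μ (k + 1) := by
  rw [Tm, ← Matrix.mul_assoc, Fq_mul_conjTranspose hν, Matrix.one_mul]

theorem Fq_mul_Tm_conjTranspose {μ ν : Quaternion ℝ} (hμ : UnitPure μ) (k : ℕ) :
    Fq μ (k + 1) * (Tm ν μ (k + 1))ᴴ = Fq ν (k + 1) := by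
  rw [Tm, Matrix.conjTranspose_mul, Matrix.conjTranspose_conjTranspose, ← Matrix.mul_assoc,
    Fq_mul_conjTranspose hμ, Matrix.one_mul]

theorem Fq_mul_comm {μ ν u : Quaternion ℝ} (hμ : UnitPure μ) (hν : UnitPure ν)
    (h : μ * u = u * ν) (k : ℕ) (p q : Fin (k + 1)) :
    Fq μ (k + 1) p q * u = u * Fq ν (k + 1) p q := by
  rw [Fq_eq hμ, Fq_eq hν, complexHom_mul_comm hμ hν h]

theorem Fq_eq_mul {μ : Quaternion ℝ} (hμ : UnitPure μ) (k : ℕ) (l m j : Fin (k + 1)) :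
    Fq μ (k + 1) l m =
      Real.sqrt (k + 1 : ℕ) • (Fq μ (k + 1) l (m - j) * Fq μ (k + 1) l j) := by
  rw [Fq_eq hμ, Fq_eq hμ, Fq_eq hμ, dftC_eq_mul k l m j, ← map_mul, ← map_smul,
    Complex.real_smul]

theorem Fq_revIdx {μ : Quaternion ℝ} (hμ : UnitPure μ) (k : ℕ) (l m : Fin (k + 1)) :
    Fq μ (k + 1) l (revIdx m) = star (Fq μ (k + 1) l m) := by
  rw [Fq_eq hμ, Fq_eq hμ, revIdx_eq_neg, dftC_neg, star_complexHom hμ]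

theorem sum_Fq_mul_circulant {μ ν u : Quaternion ℝ} (hμ : UnitPure μ) (hν : UnitPure ν)
    (h : μ * u = u * ν) {k : ℕ} (a : Fin (k + 1) → ℝ) (l j : Fin (k + 1)) :
    ∑ m, Fq μ (k + 1) l m * (u * ∑ i, (a (m - i) : Quaternion ℝ) * Tm ν μ (k + 1) i j) =
      Real.sqrt (k + 1 : ℕ) •
        ((∑ m, Fq μ (k + 1) l m * (u * (a m : Quaternion ℝ))) * Fq μ (k + 1) l j) := by
  have hcirc (i : Fin (k + 1)) :
      ∑ m, Fq ν (k + 1) l m * (a (m - i) : Quaternion ℝ) =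
        Real.sqrt (k + 1 : ℕ) •
          ((∑ m, Fq ν (k + 1) l m * (a m : Quaternion ℝ)) * Fq ν (k + 1) l i) := by
    rw [← Equiv.sum_comp (Equiv.subRight i) fun m => Fq ν (k + 1) l m * (a m : Quaternion ℝ),
      Finset.sum_mul, Finset.smul_sum]
    refine Finset.sum_congr rfl fun m _ => ?_
    rw [Fq_eq_mul hν k l m i]
    simp only [Equiv.subRight_apply, Quaternion.mul_coe_eq_smul, smul_mul_assoc]
  have hT : ∑ i, Fq ν (k + 1) l i * Tm ν μ (k + 1) i j = Fq μ (k + 1) l j := by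
    rw [← Matrix.mul_apply, Fq_mul_Tm hν]
  simp only [← mul_assoc, Fq_mul_comm hμ hν h]
  simp only [mul_assoc, ← Finset.mul_sum]
  rw [← mul_smul_comm]
  congr 1
  calc _ = ∑ i, (∑ m, Fq ν (k + 1) l m * (a (m - i) : Quaternion ℝ)) * Tm ν μ (k + 1) i j := by
        simp only [Finset.mul_sum, Finset.sum_mul, mul_assoc]
        exact Finset.sum_comm
    _ = _ := by
        simp only [hcirc, smul_mul_assoc, mul_assoc, ← Finset.smul_sum, ← Finset.mul_sum, hT]

theorem sum_Fq_mul_Tm_conjTranspose {μ ν u : Quaternion ℝ} (hμ : UnitPure μ) (hν : UnitPure ν)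
    (h : μ * u = u * ν) {k : ℕ} (a : Fin (k + 1) → ℝ) (l : Fin (k + 1)) :
    ∑ m, Fq μ (k + 1) l m *
        ((∑ i, (Tm ν μ (k + 1))ᴴ m i * (a (revIdx i) : Quaternion ℝ)) * star u) =
      star (∑ m, Fq μ (k + 1) l m * (u * (a m : Quaternion ℝ))) := by
  have hT (i) : ∑ m, Fq μ (k + 1) l m * (Tm ν μ (k + 1))ᴴ m i = Fq ν (k + 1) l i := by
    rw [← Matrix.mul_apply, Fq_mul_Tm_conjTranspose hμ]
  calc _ = ∑ i, (∑ m, Fq μ (k + 1) l m * (Tm ν μ (k + 1))ᴴ m i) *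
          ((a (revIdx i) : Quaternion ℝ) * star u) := by
        simp only [Finset.mul_sum, Finset.sum_mul, mul_assoc]
        exact Finset.sum_comm
    _ = ∑ i, Fq ν (k + 1) l (revIdx i) * ((a (revIdx (revIdx i)) : Quaternion ℝ) * star u) := by
        simp only [hT, revIdx_eq_neg]
        exact (Equiv.sum_comp (Equiv.neg (Fin (k + 1)))
          fun i => Fq ν (k + 1) l i * ((a (-i) : Quaternion ℝ) * star u)).symm
    _ = _ := by
        simp only [star_sum, Fq_revIdx hν]
        refine Finset.sum_congr rfl fun m _ => ?_
        rw [← mul_assoc (Fq μ _ l m), Fq_mul_comm hμ hν h]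
        simp [revIdx_eq_neg, Quaternion.mul_coe_eq_smul, Quaternion.coe_mul_eq_smul]

/-- The `l`-th frontal slice of the normalized QDFT of a tensor along its third mode. -/
def dftSlice {a b c : ℕ} (μ : Quaternion ℝ) (A : QTensor a b c) (l : Fin c) :
    Matrix (Fin a) (Fin b) (Quaternion ℝ) := fun p q => ∑ m, Fq μ c l m * A p q m

theorem UnitPure.mui {μ : Quaternion ℝ} (hμ : UnitPure μ) : UnitPure (mui μ) := by
  obtain ⟨h0, h1⟩ := hμ
  refine ⟨rfl, ?_⟩
  have h : ‖QTpaper.mui μ‖ * ‖QTpaper.mui μ‖ = ‖μ‖ * ‖μ‖ := by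
    rw [← Quaternion.normSq_eq_norm_mul_self, ← Quaternion.normSq_eq_norm_mul_self,
      Quaternion.normSq_def', Quaternion.normSq_def', h0]
    simp only [QTpaper.mui]
    ring
  rw [← h1]
  exact (mul_self_inj (norm_nonneg _) (norm_nonneg _)).1 h

theorem UnitPure.muj {μ : Quaternion ℝ} (hμ : UnitPure μ) : UnitPure (muj μ) := by
  obtain ⟨h0, h1⟩ := hμ
  refine ⟨rfl, ?_⟩
  have h : ‖QTpaper.muj μ‖ * ‖QTpaper.muj μ‖ = ‖μ‖ * ‖μ‖ := by
    rw [← Quaternion.normSq_eq_norm_mul_self, ← Quaternion.normSq_eq_norm_mul_self,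
      Quaternion.normSq_def', Quaternion.normSq_def', h0]
    simp only [QTpaper.muj]
    ring
  rw [← h1]
  exact (mul_self_inj (norm_nonneg _) (norm_nonneg _)).1 h

theorem UnitPure.muk {μ : Quaternion ℝ} (hμ : UnitPure μ) : UnitPure (muk μ) := by
  obtain ⟨h0, h1⟩ := hμ
  refine ⟨rfl, ?_⟩
  have h : ‖QTpaper.muk μ‖ * ‖QTpaper.muk μ‖ = ‖μ‖ * ‖μ‖ := by
    rw [← Quaternion.normSq_eq_norm_mul_self, ← Quaternion.normSq_eq_norm_mul_self,
      Quaternion.normSq_def', Quaternion.normSq_def', h0]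
    simp only [QTpaper.muk]
    ring
  rw [← h1]
  exact (mul_self_inj (norm_nonneg _) (norm_nonneg _)).1 h

theorem mul_qi {μ : Quaternion ℝ} (hμ : UnitPure μ) : μ * qi = qi * mui μ := by
  ext <;> simp <;> simp [qi, mui, hμ.1]

theorem mul_qj {μ : Quaternion ℝ} (hμ : UnitPure μ) : μ * qj = qj * muj μ := by
  ext <;> simp <;> simp [qj, muj, hμ.1]

theorem mul_qk {μ : Quaternion ℝ} (hμ : UnitPure μ) : μ * qk = qk * muk μ := by
  ext <;> simp <;> simp [qk, muk, hμ.1]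

theorem eq_sum_components (x : Quaternion ℝ) :
    x = 1 * (x.re : Quaternion ℝ) + qi * (x.imI : Quaternion ℝ) + qj * (x.imJ : Quaternion ℝ)
      + qk * (x.imK : Quaternion ℝ) := by
  ext <;> simp <;> simp [qi, qj, qk]

theorem Tm_self {μ : Quaternion ℝ} (hμ : UnitPure μ) (k : ℕ) : Tm μ μ (k + 1) = 1 :=
  Fq_conjTranspose_mul hμ k

theorem dftSlice_eq {a b k : ℕ} (μ : Quaternion ℝ) (A : QTensor a b (k + 1)) (l : Fin (k + 1))
    (p : Fin a) (q : Fin b) :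
    dftSlice μ A l p q = ∑ m, Fq μ (k + 1) l m * (1 * ((A p q m).re : Quaternion ℝ))
      + ∑ m, Fq μ (k + 1) l m * (qi * ((A p q m).imI : Quaternion ℝ))
      + ∑ m, Fq μ (k + 1) l m * (qj * ((A p q m).imJ : Quaternion ℝ))
      + ∑ m, Fq μ (k + 1) l m * (qk * ((A p q m).imK : Quaternion ℝ)) := by
  simp only [dftSlice, ← Finset.sum_add_distrib, ← mul_add]
  exact Finset.sum_congr rfl fun m _ => congrArg _ (eq_sum_components _)

theorem mul_kronecker_one_apply {a b c : ℕ}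
    (M : Matrix (Fin c × Fin a) (Fin c × Fin b) (Quaternion ℝ))
    (T : Matrix (Fin c) (Fin c) (Quaternion ℝ)) (x : Fin c × Fin a) (y : Fin c × Fin b) :
    (M * (T ⊗ₖ (1 : Matrix (Fin b) (Fin b) (Quaternion ℝ)))) x y =
      ∑ i, M x (i, y.2) * T i y.1 := by
  simp [Matrix.mul_apply, Fintype.sum_prod_type, Matrix.kroneckerMap_apply, Matrix.one_apply]

theorem kronecker_one_mul_apply {b c d : ℕ} (T : Matrix (Fin c) (Fin c) (Quaternion ℝ))
    (M : Matrix (Fin c × Fin b) (Fin d) (Quaternion ℝ)) (x : Fin c × Fin b) (y : Fin d) :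
    ((T ⊗ₖ (1 : Matrix (Fin b) (Fin b) (Quaternion ℝ))) * M) x y =
      ∑ i, T x.1 i * M (i, x.2) y := by
  simp [Matrix.mul_apply, Fintype.sum_prod_type, Matrix.kroneckerMap_apply, Matrix.one_apply]

theorem dftSlice_gQt {a r b k : ℕ} {μ : Quaternion ℝ} (hμ : UnitPure μ)
    (A : QTensor a r (k + 1)) (B : QTensor r b (k + 1)) (l : Fin (k + 1)) :
    dftSlice μ (gQt μ A B) l =
      Real.sqrt (k + 1 : ℕ) • (dftSlice μ A l * dftSlice μ B l) := by
  have hg (p q m) : gQt μ A B p q m = ∑ s, ∑ j,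
      (1 * ∑ i, ((A p s (m - i)).re : Quaternion ℝ) * Tm μ μ (k + 1) i j
        + qi * ∑ i, ((A p s (m - i)).imI : Quaternion ℝ) * Tm (mui μ) μ (k + 1) i j
        + qj * ∑ i, ((A p s (m - i)).imJ : Quaternion ℝ) * Tm (muj μ) μ (k + 1) i j
        + qk * ∑ i, ((A p s (m - i)).imK : Quaternion ℝ) * Tm (muk μ) μ (k + 1) i j) *
          B s q j := by
    rw [gQt, fold3, Matrix.mul_apply, Fintype.sum_prod_type_right]
    refine Finset.sum_congr rfl fun s _ => Finset.sum_congr rfl fun j _ => ?_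
    simp only [Matrix.add_apply, Matrix.smul_apply, mul_kronecker_one_apply, smul_eq_mul,
      Tm_self hμ, circ, compE, compI, compJ, compK, unfold3]
    simp [Matrix.one_apply]
  have hc (s : Fin r) (p : Fin a) (j : Fin (k + 1)) : ∑ m, Fq μ (k + 1) l m *
      (1 * ∑ i, ((A p s (m - i)).re : Quaternion ℝ) * Tm μ μ (k + 1) i j
        + qi * ∑ i, ((A p s (m - i)).imI : Quaternion ℝ) * Tm (mui μ) μ (k + 1) i j
        + qj * ∑ i, ((A p s (m - i)).imJ : Quaternion ℝ) * Tm (muj μ) μ (k + 1) i j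
        + qk * ∑ i, ((A p s (m - i)).imK : Quaternion ℝ) * Tm (muk μ) μ (k + 1) i j) =
      Real.sqrt (k + 1 : ℕ) • (dftSlice μ A l p s * Fq μ (k + 1) l j) := by
    simp only [mul_add (Fq _ _ _ _), Finset.sum_add_distrib]
    rw [sum_Fq_mul_circulant hμ hμ (by simp) (fun m => (A p s m).re),
      sum_Fq_mul_circulant hμ hμ.mui (mul_qi hμ) (fun m => (A p s m).imI),
      sum_Fq_mul_circulant hμ hμ.muj (mul_qj hμ) (fun m => (A p s m).imJ),
      sum_Fq_mul_circulant hμ hμ.muk (mul_qk hμ) (fun m => (A p s m).imK),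
      dftSlice_eq]
    simp only [add_mul, smul_add]
  ext1 p q
  rw [Matrix.smul_apply, Matrix.mul_apply]
  calc ∑ m, Fq μ (k + 1) l m * gQt μ A B p q m
      = ∑ s, ∑ j, (∑ m, Fq μ (k + 1) l m *
      (1 * ∑ i, ((A p s (m - i)).re : Quaternion ℝ) * Tm μ μ (k + 1) i j
        + qi * ∑ i, ((A p s (m - i)).imI : Quaternion ℝ) * Tm (mui μ) μ (k + 1) i j
        + qj * ∑ i, ((A p s (m - i)).imJ : Quaternion ℝ) * Tm (muj μ) μ (k + 1) i j
        + qk * ∑ i, ((A p s (m - i)).imK : Quaternion ℝ) * Tm (muk μ) μ (k + 1) i j)) *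
          B s q j := by
        simp only [hg, Finset.mul_sum (Finset.univ : Finset (Fin r)),
          Finset.mul_sum _ _ (Fq _ _ _ _)]
        rw [Finset.sum_comm]
        refine Finset.sum_congr rfl fun s _ => ?_
        rw [Finset.sum_comm]
        refine Finset.sum_congr rfl fun j _ => ?_
        rw [Finset.sum_mul]
        exact Finset.sum_congr rfl fun m _ => (mul_assoc _ _ _).symm
    _ = _ := by
        simp only [hc, smul_mul_assoc, mul_assoc, ← Finset.smul_sum, ← Finset.mul_sum]
        rfl

theorem dftSlice_conjT {a b k : ℕ} {μ : Quaternion ℝ} (hμ : UnitPure μ)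
    (A : QTensor a b (k + 1)) (l : Fin (k + 1)) :
    dftSlice μ (conjT μ A) l = (dftSlice μ A l)ᴴ := by
  have hi : star qi = -qi := Quaternion.star_eq_neg.2 rfl
  have hj : star qj = -qj := Quaternion.star_eq_neg.2 rfl
  have hk : star qk = -qk := Quaternion.star_eq_neg.2 rfl
  ext1 q p
  have hg (m) : conjT μ A q p m =
      (∑ i, (Tm μ μ (k + 1))ᴴ m i * ((A p q (revIdx i)).re : Quaternion ℝ)) * star 1
      + (∑ i, (Tm (mui μ) μ (k + 1))ᴴ m i * ((A p q (revIdx i)).imI : Quaternion ℝ)) * star qi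
      + (∑ i, (Tm (muj μ) μ (k + 1))ᴴ m i * ((A p q (revIdx i)).imJ : Quaternion ℝ)) * star qj
      + (∑ i, (Tm (muk μ) μ (k + 1))ᴴ m i * ((A p q (revIdx i)).imK : Quaternion ℝ)) * star qk := by
    simp only [conjT, fold3, Matrix.sub_apply, rmulM, kronecker_one_mul_apply, Tm_self hμ,
      Matrix.conjTranspose_one, hi, hj,
      hk, unfold3, transT, compE, compI, compJ, compK]
    simp [Matrix.one_apply, sub_eq_add_neg]
  rw [Matrix.conjTranspose_apply, dftSlice_eq μ A l p q]
  simp only [dftSlice, hg, mul_add (Fq _ _ _ _), Finset.sum_add_distrib, star_add]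
  rw [sum_Fq_mul_Tm_conjTranspose hμ hμ (by simp) (fun m => (A p q m).re),
    sum_Fq_mul_Tm_conjTranspose hμ hμ.mui (mul_qi hμ) (fun m => (A p q m).imI),
    sum_Fq_mul_Tm_conjTranspose hμ hμ.muj (mul_qj hμ) (fun m => (A p q m).imJ),
    sum_Fq_mul_Tm_conjTranspose hμ hμ.muk (mul_qk hμ) (fun m => (A p q m).imK)]

theorem dftSlice_idT (n k : ℕ) (μ : Quaternion ℝ) (l : Fin (k + 1)) :
    dftSlice μ (idT n (k + 1)) l = (Real.sqrt (k + 1 : ℕ))⁻¹ • 1 := by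
  have h0 : Fq μ (k + 1) l 0 = ((Real.sqrt (k + 1 : ℕ))⁻¹ : ℝ) := by simp [Fq]
  ext1 p q
  rw [dftSlice, Finset.sum_eq_single 0]
  · rw [h0, Quaternion.coe_mul_eq_smul]
    simp [idT, Matrix.one_apply]
  · intro m _ hm
    have : m.1 ≠ 0 := fun h => hm (Fin.ext h)
    simp [idT, this]
  · simp

theorem sum_norm_sq_mul_of_isometry {m n : Type*} [Fintype m] [DecidableEq m] [Fintype n]
    {V : Matrix m m (Quaternion ℝ)} (hV : Vᴴ * V = 1) (X : Matrix m n (Quaternion ℝ)) :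
    ∑ p, ∑ q, ‖(V * X) p q‖ ^ 2 = ∑ p, ∑ q, ‖X p q‖ ^ 2 := by
  have key (Y : Matrix m n (Quaternion ℝ)) (q : n) :
      ((∑ p, ‖Y p q‖ ^ 2 : ℝ) : Quaternion ℝ) = (Yᴴ * Y) q q := by
    rw [Matrix.mul_apply, ← Quaternion.algebraMap_def, map_sum]
    refine Finset.sum_congr rfl fun p _ => ?_
    rw [Matrix.conjTranspose_apply, Quaternion.star_mul_self, Quaternion.normSq_eq_norm_mul_self,
      sq, Quaternion.algebraMap_def]
  rw [Finset.sum_comm, Finset.sum_comm (f := fun p q => ‖X p q‖ ^ 2)]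
  refine Finset.sum_congr rfl fun q _ => Quaternion.coe_injective ?_
  rw [key, key, Matrix.conjTranspose_mul, Matrix.mul_assoc, ← Matrix.mul_assoc Vᴴ, hV,
    Matrix.one_mul]

theorem frobT_eq_sum_dftSlice {a b k : ℕ} {μ : Quaternion ℝ} (hμ : UnitPure μ)
    (A : QTensor a b (k + 1)) :
    frobT A = Real.sqrt (∑ l, ∑ p, ∑ q, ‖dftSlice μ A l p q‖ ^ 2) := by
  have h := sum_norm_sq_mul_of_isometry (Fq_conjTranspose_mul hμ k)
    (Matrix.of fun m (x : Fin a × Fin b) => A x.1 x.2 m)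
  rw [frobT]
  congr 1
  simp only [Fintype.sum_prod_type, Matrix.mul_apply, Matrix.of_apply] at h
  simp only [dftSlice, h]
  exact (Finset.sum_congr rfl fun p _ => Finset.sum_comm).trans Finset.sum_comm

/-- unitary tensors preserve the Frobenius norm under gQt-multiplication. -/
theorem unitaryT_gQt_frobenius {n n₂ n₃ : ℕ} (μ : Quaternion ℝ) (hμ : UnitPure μ)
    (U : QTensor n n n₃) (hU : unitaryT μ U) (A : QTensor n n₂ n₃) :
    frobT (gQt μ U A) = frobT A := by
  obtain _ | k := n₃
  · simp [frobT]
  have hs : Real.sqrt (k + 1 : ℕ) ≠ 0 := by positivity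
  have hV (l : Fin (k + 1)) : (Real.sqrt (k + 1 : ℕ) • dftSlice μ U l)ᴴ *
      (Real.sqrt (k + 1 : ℕ) • dftSlice μ U l) = 1 := by
    have h := congrArg (dftSlice μ · l) hU.1
    simp only [dftSlice_gQt hμ, dftSlice_conjT hμ, dftSlice_idT] at h
    have hstar : (Real.sqrt (k + 1 : ℕ) • dftSlice μ U l)ᴴ =
        Real.sqrt (k + 1 : ℕ) • (dftSlice μ U l)ᴴ := by
      ext1 p q
      simp only [Matrix.conjTranspose_apply, Matrix.smul_apply, Quaternion.star_smul]
    rw [hstar, Matrix.smul_mul, Matrix.mul_smul, h, smul_smul,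
      mul_inv_cancel₀ hs, one_smul]
  rw [frobT_eq_sum_dftSlice hμ, frobT_eq_sum_dftSlice hμ]
  congr 1
  refine Finset.sum_congr rfl fun l _ => ?_
  rw [dftSlice_gQt hμ, ← Matrix.smul_mul, sum_norm_sq_mul_of_isometry (hV l)]

end QTpaper
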